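/- (Lagged-moment identity for the ABC-MCMC chain with simple cut-off.) Let 0 < ε ≤ δ with c_δ > 0 and c_ε > 0, let f: T → ℝ be measurable with ∫ f² dπ_ε < ∞, and set h(θ,y) = 1{d(y,y*) ≤ ε} f(θ), w̄(θ) = L_ε(θ)/L_δ(θ), f_w = f·w̄. Then for every k ≥ 1, ∫ h(θ,y) (P̃_δ^k h)(θ,y) π̃_δ(dθ,dy) = ∫ f_w(θ) (Ṗ_δ^k f_w)(θ) π_δ(dθ) + ∫ [h(θ,y)² − f_w(θ)²] r_δ(θ)^k π̃_δ(dθ,dy), where Ṗ_δ is the marginal θ-kernel and r_δ(θ) the rejection probability. -/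

import Mathlib

open MeasureTheory ProbabilityTheory
open scoped ENNReal

noncomputable section

namespace ABCsimple

variable {T Y : Type*} [MeasurableSpace T] [MeasurableSpace Y]

/-- Simple cut-off kernel value `K_ε(y) = 1{d(y,y*) ≤ ε}`. -/
def K (d : Y → ℝ) (ε : ℝ) (y : Y) : ℝ := if d y ≤ ε then 1 else 0

/-- ABC likelihood `L_ε(θ) = ∫ K_ε(y) g(θ,dy)`. -/
def L (g : Kernel T Y) (d : Y → ℝ) (ε : ℝ) (θ : T) : ℝ := ∫ y, K d ε y ∂(g θ)

/-- Normalising constant `c_ε = ∫ pr(θ) L_ε(θ) ν(dθ)`. -/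
def c (ν : Measure T) (pr : T → ℝ) (g : Kernel T Y) (d : Y → ℝ) (ε : ℝ) : ℝ :=
  ∫ θ, pr θ * L g d ε θ ∂ν

/-- ABC posterior `π_ε(dθ) = c_ε⁻¹ pr(θ) L_ε(θ) ν(dθ)`. -/
def piPost (ν : Measure T) (pr : T → ℝ) (g : Kernel T Y) (d : Y → ℝ) (ε : ℝ) : Measure T :=
  (ENNReal.ofReal (c ν pr g d ε))⁻¹ •
    ν.withDensity (fun θ => ENNReal.ofReal (pr θ * L g d ε θ))

/-- Joint ABC target `π̃_ε(dθ,dy) = c_ε⁻¹ pr(θ) K_ε(y) g(θ,dy) ν(dθ)`. -/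
def piJoint (ν : Measure T) (pr : T → ℝ) (g : Kernel T Y) (d : Y → ℝ) (ε : ℝ) :
    Measure (T × Y) :=
  (ENNReal.ofReal (c ν pr g d ε))⁻¹ •
    (ν ⊗ₘ g).withDensity (fun p => ENNReal.ofReal (pr p.1 * K d ε p.2))

/-- `w̄(θ) = L_ε(θ)/L_δ(θ)`. -/
def wbar (g : Kernel T Y) (d : Y → ℝ) (δ ε : ℝ) (θ : T) : ℝ := L g d ε θ / L g d δ θ


/-- Metropolis–Hastings acceptance probability of ABC-MCMC(δ),
`α_δ(θ,y;θ',y') = min{1, pr(θ')q(θ',θ)K_δ(y') / (pr(θ)q(θ,θ')K_δ(y))}`. -/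
def accept (pr : T → ℝ) (q : T → T → ℝ) (d : Y → ℝ) (δ : ℝ) (p p' : T × Y) : ℝ :=
  min 1 (pr p'.1 * q p'.1 p.1 * K d δ p'.2 / (pr p.1 * q p.1 p'.1 * K d δ p.2))

/-- The transition operator `P̃_δ` of ABC-MCMC(δ) acting on functions. -/
def MHop (ν : Measure T) (g : Kernel T Y) (pr : T → ℝ) (q : T → T → ℝ) (d : Y → ℝ) (δ : ℝ)
    (h : T × Y → ℝ) : T × Y → ℝ :=
  fun p =>
    (∫ ϑ, q p.1 ϑ * ∫ y', accept pr q d δ p (ϑ, y') * h (ϑ, y') ∂(g ϑ) ∂ν)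
      + (1 - ∫ ϑ, q p.1 ϑ * ∫ y', accept pr q d δ p (ϑ, y') ∂(g ϑ) ∂ν) * h p

/-- `α̇(θ,ϑ) = min{1, pr(ϑ)q(ϑ,θ)/(pr(θ)q(θ,ϑ))}`. -/
def alphadot (pr : T → ℝ) (q : T → T → ℝ) (θ ϑ : T) : ℝ :=
  min 1 (pr ϑ * q ϑ θ / (pr θ * q θ ϑ))

/-- Rejection probability `r_δ(θ) = 1 - ∫ q(θ,ϑ) α̇(θ,ϑ) L_δ(ϑ) ν(dϑ)`. -/
def rej (ν : Measure T) (g : Kernel T Y) (pr : T → ℝ) (q : T → T → ℝ) (d : Y → ℝ) (δ : ℝ)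
    (θ : T) : ℝ :=
  1 - ∫ ϑ, q θ ϑ * alphadot pr q θ ϑ * L g d δ ϑ ∂ν

/-- The marginal θ-chain operator `Ṗ_δ` acting on functions. -/
def Pdotop (ν : Measure T) (g : Kernel T Y) (pr : T → ℝ) (q : T → T → ℝ) (d : Y → ℝ) (δ : ℝ)
    (f : T → ℝ) : T → ℝ :=
  fun θ => (∫ ϑ, q θ ϑ * alphadot pr q θ ϑ * L g d δ ϑ * f ϑ ∂ν)
    + rej ν g pr q d δ θ * f θ

end ABCsimple

open ABCsimple

namespace ABCsimple

section Cutoff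

variable {Y : Type*}

lemma K_nonneg (d : Y → ℝ) (ε : ℝ) (y : Y) : 0 ≤ K d ε y := by
  unfold K; split_ifs <;> norm_num

lemma K_le_one (d : Y → ℝ) (ε : ℝ) (y : Y) : K d ε y ≤ 1 := by
  unfold K; split_ifs <;> norm_num

lemma K_mul_self (d : Y → ℝ) (ε : ℝ) (y : Y) : K d ε y * K d ε y = K d ε y := by
  unfold K; split_ifs <;> norm_num

lemma K_mul_K {ε δ : ℝ} (hεδ : ε ≤ δ) (d : Y → ℝ) (y : Y) :
    K d δ y * K d ε y = K d ε y := by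
  unfold K
  split_ifs with h₁ h₂
  · norm_num
  · norm_num
  · exact absurd (‹d y ≤ ε›.trans hεδ) h₁
  · norm_num

lemma measurable_K [MeasurableSpace Y] {d : Y → ℝ} (hd : Measurable d) (ε : ℝ) :
    Measurable (K d ε) :=
  Measurable.ite (measurableSet_le hd measurable_const) measurable_const measurable_const

lemma integrable_K [MeasurableSpace Y] {d : Y → ℝ} (hd : Measurable d) (ε : ℝ) (μ : Measure Y)
    [IsFiniteMeasure μ] :
    Integrable (K d ε) μ := by
  refine Integrable.of_bound (measurable_K hd ε).aestronglyMeasurable 1 (ae_of_all _ fun y => ?_)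
  rw [Real.norm_of_nonneg (K_nonneg d ε y)]
  exact K_le_one d ε y

end Cutoff

section Likelihood

variable {T Y : Type*} [MeasurableSpace T] [MeasurableSpace Y] (g : Kernel T Y)

lemma L_nonneg (d : Y → ℝ) (ε : ℝ) (θ : T) : 0 ≤ L g d ε θ :=
  integral_nonneg fun y => K_nonneg d ε y

lemma L_le_one [IsMarkovKernel g] {d : Y → ℝ} (hd : Measurable d) (ε : ℝ)
    (θ : T) : L g d ε θ ≤ 1 := by
  calc L g d ε θ ≤ ∫ _, (1 : ℝ) ∂(g θ) :=
        integral_mono (integrable_K hd ε _) (integrable_const _) (K_le_one d ε)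
    _ = 1 := by simp

lemma L_mono [IsMarkovKernel g] {d : Y → ℝ} (hd : Measurable d) {ε δ : ℝ} (hεδ : ε ≤ δ) (θ : T) :
    L g d ε θ ≤ L g d δ θ := by
  refine integral_mono (integrable_K hd ε _) (integrable_K hd δ _) fun y => ?_
  rw [← K_mul_K hεδ]
  exact mul_le_of_le_one_right (K_nonneg d δ y) (K_le_one d ε y)

lemma lintegral_ofReal_K [IsMarkovKernel g] {d : Y → ℝ} (hd : Measurable d) (ε : ℝ) (θ : T) :
    ∫⁻ y, ENNReal.ofReal (K d ε y) ∂(g θ) = ENNReal.ofReal (L g d ε θ) :=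
  (ofReal_integral_eq_lintegral_ofReal (integrable_K hd ε _)
    (ae_of_all _ (K_nonneg d ε))).symm

lemma measurable_L [IsMarkovKernel g] {d : Y → ℝ} (hd : Measurable d) (ε : ℝ) :
    Measurable (L g d ε) := by
  have h : L g d ε = fun θ => (∫⁻ y, ENNReal.ofReal (K d ε y) ∂(g θ)).toReal := by
    ext θ
    rw [lintegral_ofReal_K g hd, ENNReal.toReal_ofReal (L_nonneg g d ε θ)]
  rw [h]
  exact ((measurable_K hd ε).ennreal_ofReal.lintegral_kernel).ennreal_toReal

lemma L_mul_wbar [IsMarkovKernel g] {d : Y → ℝ} (hd : Measurable d) {ε δ : ℝ} (hεδ : ε ≤ δ)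
    (θ : T) :
    L g d δ θ * wbar g d δ ε θ = L g d ε θ := by
  unfold wbar
  by_cases h : L g d δ θ = 0
  · have h₁ := L_mono g hd hεδ θ
    have h₂ := L_nonneg g d ε θ
    rw [h, zero_mul]
    linarith
  · exact mul_div_cancel₀ _ h

lemma wbar_nonneg (d : Y → ℝ) (δ ε : ℝ) (θ : T) : 0 ≤ wbar g d δ ε θ :=
  div_nonneg (L_nonneg g d ε θ) (L_nonneg g d δ θ)

lemma wbar_le_one [IsMarkovKernel g] {d : Y → ℝ} (hd : Measurable d) {ε δ : ℝ} (hεδ : ε ≤ δ)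
    (θ : T) :
    wbar g d δ ε θ ≤ 1 :=
  div_le_one_of_le₀ (L_mono g hd hεδ θ) (L_nonneg g d δ θ)

lemma measurable_wbar [IsMarkovKernel g] {d : Y → ℝ} (hd : Measurable d) (δ ε : ℝ) :
    Measurable (wbar g d δ ε) :=
  (measurable_L g hd ε).div (measurable_L g hd δ)

end Likelihood

section Marginal

variable {T : Type*} {pr : T → ℝ} {q : T → T → ℝ}

lemma alphadot_nonneg (hpr : ∀ θ, 0 ≤ pr θ) (hq : ∀ θ ϑ, 0 ≤ q θ ϑ) (θ ϑ : T) :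
    0 ≤ alphadot pr q θ ϑ :=
  le_min zero_le_one (div_nonneg (mul_nonneg (hpr _) (hq _ _)) (mul_nonneg (hpr _) (hq _ _)))

lemma alphadot_le_one (θ ϑ : T) : alphadot pr q θ ϑ ≤ 1 := min_le_left _ _

/-- On `{K_δ(y) = 1}` the acceptance probability factorises. -/
lemma accept_eq {Y : Type*} {d : Y → ℝ} {δ : ℝ} {p : T × Y} (hp : K d δ p.2 = 1) (ϑ : T) (y' : Y) :
    accept pr q d δ p (ϑ, y') = alphadot pr q p.1 ϑ * K d δ y' := by
  unfold accept alphadot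
  rw [hp]
  unfold K
  split_ifs <;> simp

lemma pr_mul_q_mul_alphadot (hpr : ∀ θ, 0 ≤ pr θ) (hq : ∀ θ ϑ, 0 ≤ q θ ϑ) (θ ϑ : T) :
    pr θ * q θ ϑ * alphadot pr q θ ϑ = min (pr θ * q θ ϑ) (pr ϑ * q ϑ θ) := by
  have h₁ : 0 ≤ pr θ * q θ ϑ := mul_nonneg (hpr _) (hq _ _)
  have h₂ : 0 ≤ pr ϑ * q ϑ θ := mul_nonneg (hpr _) (hq _ _)
  unfold alphadot
  rcases h₁.eq_or_lt with h | h
  · rw [← h, zero_mul, min_eq_left h₂]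
  · rw [mul_min_of_nonneg _ _ h₁, mul_one, mul_div_cancel₀ _ h.ne']

lemma measurable_alphadot [MeasurableSpace T] (hpr : Measurable pr)
    (hq : Measurable fun p : T × T => q p.1 p.2) :
    Measurable fun p : T × T => alphadot pr q p.1 p.2 := by
  have hq' : Measurable fun p : T × T => q p.2 p.1 := hq.comp measurable_swap
  unfold alphadot
  exact measurable_const.min
    (((hpr.comp measurable_snd).mul hq').div ((hpr.comp measurable_fst).mul hq))

end Marginal

/-- Jensen's inequality for a sub-probability density. -/
lemma sq_lintegral_mul_le {α : Type*} [MeasurableSpace α] {μ : Measure α} {m v : α → ℝ≥0∞}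
    (hm : Measurable m) (hv : Measurable v) (hm1 : ∫⁻ a, m a ∂μ ≤ 1) :
    (∫⁻ a, m a * v a ∂μ) ^ 2 ≤ ∫⁻ a, m a * v a ^ 2 ∂μ := by
  have h := ENNReal.lintegral_mul_norm_pow_le (μ := μ) hm.aemeasurable
    (hm.mul (hv.pow_const 2)).aemeasurable (p := 1 / 2) (q := 1 / 2)
    (by norm_num) (by norm_num) (by norm_num)
  have hpt : ∀ a, m a ^ (1 / 2 : ℝ) * (m * fun a => v a ^ 2) a ^ (1 / 2 : ℝ) = m a * v a := by
    intro a
    rw [Pi.mul_apply, ENNReal.mul_rpow_of_nonneg _ _ (by norm_num), ← mul_assoc,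
      ← ENNReal.rpow_add_of_nonneg _ _ (by norm_num) (by norm_num), ← ENNReal.rpow_natCast,
      ← ENNReal.rpow_mul]
    norm_num
  simp only [hpt] at h
  calc (∫⁻ a, m a * v a ∂μ) ^ 2
      ≤ ((∫⁻ a, m a * v a ^ 2 ∂μ) ^ (1 / 2 : ℝ)) ^ 2 := by
        gcongr
        refine h.trans ?_
        refine mul_le_of_le_one_left' ?_
        exact ENNReal.rpow_le_one hm1 (by norm_num)
    _ = ∫⁻ a, m a * v a ^ 2 ∂μ := by
        rw [← ENNReal.rpow_natCast, ← ENNReal.rpow_mul]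
        norm_num

section Chain

variable {T Y : Type*} [MeasurableSpace T] [MeasurableSpace Y]
  {ν : Measure T} {pr : T → ℝ} {g : Kernel T Y}
  {d : Y → ℝ} {q : T → T → ℝ}

/-- Density of the accepted moves of the marginal chain. -/
def moveDensity (g : Kernel T Y) (pr : T → ℝ) (q : T → T → ℝ) (d : Y → ℝ) (δ : ℝ)
    (θ ϑ : T) : ℝ :=
  q θ ϑ * alphadot pr q θ ϑ * L g d δ ϑ

lemma moveDensity_nonneg (hpr : ∀ θ, 0 ≤ pr θ) (hq : ∀ θ ϑ, 0 ≤ q θ ϑ) (δ : ℝ) (θ ϑ : T) :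
    0 ≤ moveDensity g pr q d δ θ ϑ :=
  mul_nonneg (mul_nonneg (hq _ _) (alphadot_nonneg hpr hq _ _)) (L_nonneg g d δ ϑ)

lemma moveDensity_le [IsMarkovKernel g] (hd : Measurable d) (hpr : ∀ θ, 0 ≤ pr θ)
    (hq : ∀ θ ϑ, 0 ≤ q θ ϑ)
    (δ : ℝ) (θ ϑ : T) : moveDensity g pr q d δ θ ϑ ≤ q θ ϑ := by
  unfold moveDensity
  have h₁ : q θ ϑ * alphadot pr q θ ϑ ≤ q θ ϑ :=
    mul_le_of_le_one_right (hq _ _) (alphadot_le_one θ ϑ)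
  refine le_trans (mul_le_of_le_one_right ?_ (L_le_one g hd δ ϑ)) h₁
  exact mul_nonneg (hq _ _) (alphadot_nonneg hpr hq _ _)

lemma measurable_moveDensity [IsMarkovKernel g] (hd : Measurable d) (hpr : Measurable pr)
    (hq : Measurable fun p : T × T => q p.1 p.2) (δ : ℝ) :
    Measurable fun p : T × T => moveDensity g pr q d δ p.1 p.2 :=
  (hq.mul (measurable_alphadot hpr hq)).mul ((measurable_L g hd δ).comp measurable_snd)

lemma moveDensity_symm (hpr : ∀ θ, 0 ≤ pr θ) (hq : ∀ θ ϑ, 0 ≤ q θ ϑ) (δ : ℝ) (θ ϑ : T) :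
    pr θ * L g d δ θ * moveDensity g pr q d δ θ ϑ
      = pr ϑ * L g d δ ϑ * moveDensity g pr q d δ ϑ θ := by
  have h₁ := pr_mul_q_mul_alphadot hpr hq θ ϑ
  have h₂ := pr_mul_q_mul_alphadot hpr hq ϑ θ
  rw [min_comm, ← h₁] at h₂
  unfold moveDensity
  linear_combination -(L g d δ θ * L g d δ ϑ) * h₂

lemma integrable_proposal (hq_prob : ∀ θ, ∫ ϑ, q θ ϑ ∂ν = 1) (θ : T) : Integrable (q θ) ν := by
  by_contra h
  have := hq_prob θ
  rw [integral_undef h] at this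
  norm_num at this

lemma lintegral_moveDensity_le [IsMarkovKernel g] (hd : Measurable d) (hpr : ∀ θ, 0 ≤ pr θ)
    (hq : ∀ θ ϑ, 0 ≤ q θ ϑ) (hq_prob : ∀ θ, ∫ ϑ, q θ ϑ ∂ν = 1) (δ : ℝ) (θ : T) :
    ∫⁻ ϑ, ENNReal.ofReal (moveDensity g pr q d δ θ ϑ) ∂ν ≤ 1 := by
  calc ∫⁻ ϑ, ENNReal.ofReal (moveDensity g pr q d δ θ ϑ) ∂ν
      ≤ ∫⁻ ϑ, ENNReal.ofReal (q θ ϑ) ∂ν :=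
        lintegral_mono fun ϑ => ENNReal.ofReal_le_ofReal (moveDensity_le hd hpr hq δ θ ϑ)
    _ = 1 := by
        rw [← ofReal_integral_eq_lintegral_ofReal (integrable_proposal hq_prob θ)
          (ae_of_all _ (hq θ)), hq_prob, ENNReal.ofReal_one]

lemma rej_nonneg [IsMarkovKernel g] (hd : Measurable d) (hpr : ∀ θ, 0 ≤ pr θ)
    (hq : ∀ θ ϑ, 0 ≤ q θ ϑ)
    (hq_prob : ∀ θ, ∫ ϑ, q θ ϑ ∂ν = 1) (δ : ℝ) (θ : T) : 0 ≤ rej ν g pr q d δ θ := by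
  have h : ∫ ϑ, moveDensity g pr q d δ θ ϑ ∂ν ≤ ∫ ϑ, q θ ϑ ∂ν :=
    integral_mono_of_nonneg (ae_of_all _ (moveDensity_nonneg hpr hq δ θ))
      (integrable_proposal hq_prob θ) (ae_of_all _ (moveDensity_le hd hpr hq δ θ))
  rw [hq_prob] at h
  exact sub_nonneg.mpr h

lemma rej_le_one [IsMarkovKernel g] (hpr : ∀ θ, 0 ≤ pr θ) (hq : ∀ θ ϑ, 0 ≤ q θ ϑ) (δ : ℝ) (θ : T) :
    rej ν g pr q d δ θ ≤ 1 :=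
  sub_le_self _ (integral_nonneg (moveDensity_nonneg hpr hq δ θ))

lemma measurable_integral_moveDensity_mul [SigmaFinite ν] [IsMarkovKernel g] (hd : Measurable d)
    (hpr : Measurable pr)
    (hq : Measurable fun p : T × T => q p.1 p.2) (δ : ℝ) {u : T → ℝ} (hu : Measurable u) :
    Measurable fun θ => ∫ ϑ, moveDensity g pr q d δ θ ϑ * u ϑ ∂ν :=
  (StronglyMeasurable.integral_prod_right (f := fun θ ϑ => moveDensity g pr q d δ θ ϑ * u ϑ)
    ((measurable_moveDensity hd hpr hq δ).mul
      (hu.comp measurable_snd)).stronglyMeasurable).measurable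

lemma measurable_rej [SigmaFinite ν] [IsMarkovKernel g] (hd : Measurable d) (hpr : Measurable pr)
    (hq : Measurable fun p : T × T => q p.1 p.2) (δ : ℝ) :
    Measurable (rej ν g pr q d δ) := by
  have h := measurable_integral_moveDensity_mul (ν := ν) (g := g) hd hpr hq δ
    (measurable_const (a := (1 : ℝ)))
  simp only [mul_one] at h
  exact measurable_const.sub h

lemma measurable_Pdotop [SigmaFinite ν] [IsMarkovKernel g] (hd : Measurable d) (hpr : Measurable pr)
    (hq : Measurable fun p : T × T => q p.1 p.2) (δ : ℝ) {u : T → ℝ} (hu : Measurable u) :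
    Measurable (Pdotop ν g pr q d δ u) :=
  (measurable_integral_moveDensity_mul hd hpr hq δ hu).add
    ((measurable_rej hd hpr hq δ).mul hu)

/-- Reversibility makes the accepted-move operator a contraction of `L²(π_δ)`. -/
lemma lintegral_sq_move_le [SigmaFinite ν] [IsMarkovKernel g] (hd : Measurable d)
    (hpr : Measurable pr) (hpr0 : ∀ θ, 0 ≤ pr θ)
    (hq : Measurable fun p : T × T => q p.1 p.2) (hq0 : ∀ θ ϑ, 0 ≤ q θ ϑ)
    (hq_prob : ∀ θ, ∫ ϑ, q θ ϑ ∂ν = 1) (δ : ℝ) {u : T → ℝ} (hu : Measurable u) :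
    ∫⁻ θ, ENNReal.ofReal (pr θ * L g d δ θ)
        * ‖∫ ϑ, moveDensity g pr q d δ θ ϑ * u ϑ ∂ν‖ₑ ^ 2 ∂ν
      ≤ ∫⁻ θ, ENNReal.ofReal (pr θ * L g d δ θ) * ‖u θ‖ₑ ^ 2 ∂ν := by
  set m := moveDensity g pr q d δ with hm
  have hmm : Measurable fun p : T × T => ENNReal.ofReal (m p.1 p.2) :=
    (measurable_moveDensity hd hpr hq δ).ennreal_ofReal
  have hm_right : ∀ θ, Measurable fun ϑ => ENNReal.ofReal (m θ ϑ) :=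
    fun θ => hmm.comp measurable_prodMk_left
  have hw : Measurable fun θ => ENNReal.ofReal (pr θ * L g d δ θ) :=
    (hpr.mul (measurable_L g hd δ)).ennreal_ofReal
  have hw0 : ∀ θ, 0 ≤ pr θ * L g d δ θ := fun θ => mul_nonneg (hpr0 θ) (L_nonneg g d δ θ)
  have hu2 : Measurable fun θ => ‖u θ‖ₑ ^ 2 := hu.enorm.pow_const 2
  calc ∫⁻ θ, ENNReal.ofReal (pr θ * L g d δ θ) * ‖∫ ϑ, m θ ϑ * u ϑ ∂ν‖ₑ ^ 2 ∂ν
      ≤ ∫⁻ θ, ENNReal.ofReal (pr θ * L g d δ θ)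
          * ∫⁻ ϑ, ENNReal.ofReal (m θ ϑ) * ‖u ϑ‖ₑ ^ 2 ∂ν ∂ν := by
        refine lintegral_mono fun θ => mul_le_mul_right ?_ _
        refine le_trans ?_ (sq_lintegral_mul_le (hm_right θ) hu.enorm
          (lintegral_moveDensity_le hd hpr0 hq0 hq_prob δ θ))
        gcongr
        refine (enorm_integral_le_lintegral_enorm _).trans_eq (lintegral_congr fun ϑ => ?_)
        rw [enorm_mul, Real.enorm_of_nonneg (moveDensity_nonneg hpr0 hq0 δ θ ϑ)]
    _ = ∫⁻ θ, ∫⁻ ϑ, ENNReal.ofReal (pr θ * L g d δ θ)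
          * (ENNReal.ofReal (m θ ϑ) * ‖u ϑ‖ₑ ^ 2) ∂ν ∂ν :=
        lintegral_congr fun θ => (lintegral_const_mul _ ((hm_right θ).mul hu2)).symm
    _ = ∫⁻ ϑ, ∫⁻ θ, ENNReal.ofReal (pr θ * L g d δ θ)
          * (ENNReal.ofReal (m θ ϑ) * ‖u ϑ‖ₑ ^ 2) ∂ν ∂ν :=
        lintegral_lintegral_swap ((hw.comp measurable_fst).mul
          (hmm.mul (hu2.comp measurable_snd))).aemeasurable
    _ = ∫⁻ ϑ, ∫⁻ θ, ENNReal.ofReal (pr ϑ * L g d δ ϑ) * ‖u ϑ‖ₑ ^ 2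
          * ENNReal.ofReal (m ϑ θ) ∂ν ∂ν := by
        refine lintegral_congr fun ϑ => lintegral_congr fun θ => ?_
        rw [← mul_assoc, ← ENNReal.ofReal_mul (hw0 θ), moveDensity_symm hpr0 hq0,
          ENNReal.ofReal_mul (hw0 ϑ), mul_right_comm]
    _ = ∫⁻ ϑ, ENNReal.ofReal (pr ϑ * L g d δ ϑ) * ‖u ϑ‖ₑ ^ 2
          * ∫⁻ θ, ENNReal.ofReal (m ϑ θ) ∂ν ∂ν :=
        lintegral_congr fun ϑ => lintegral_const_mul _ (hm_right ϑ)
    _ ≤ ∫⁻ θ, ENNReal.ofReal (pr θ * L g d δ θ) * ‖u θ‖ₑ ^ 2 ∂ν :=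
        lintegral_mono fun ϑ => mul_le_of_le_one_right'
          (lintegral_moveDensity_le hd hpr0 hq0 hq_prob δ ϑ)

lemma integrable_weight_sq_iff [IsMarkovKernel g] (hd : Measurable d) (hpr : Measurable pr)
    (hpr0 : ∀ θ, 0 ≤ pr θ) (δ : ℝ) {u : T → ℝ} (hu : Measurable u) :
    Integrable (fun θ => pr θ * L g d δ θ * u θ ^ 2) ν
      ↔ ∫⁻ θ, ENNReal.ofReal (pr θ * L g d δ θ) * ‖u θ‖ₑ ^ 2 ∂ν < ⊤ := by
  have hmeas : Measurable fun θ => pr θ * L g d δ θ * u θ ^ 2 :=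
    (hpr.mul (measurable_L g hd δ)).mul (hu.pow_const 2)
  rw [Integrable, and_iff_right hmeas.aestronglyMeasurable, HasFiniteIntegral]
  simp only [enorm_mul, enorm_pow, ENNReal.ofReal_mul (hpr0 _), Real.enorm_of_nonneg (hpr0 _),
    Real.enorm_of_nonneg (L_nonneg g d δ _)]

lemma integrable_weight_sq_Pdotop [SigmaFinite ν] [IsMarkovKernel g] (hd : Measurable d)
    (hpr : Measurable pr)
    (hpr0 : ∀ θ, 0 ≤ pr θ) (hq : Measurable fun p : T × T => q p.1 p.2)
    (hq0 : ∀ θ ϑ, 0 ≤ q θ ϑ) (hq_prob : ∀ θ, ∫ ϑ, q θ ϑ ∂ν = 1) (δ : ℝ) {u : T → ℝ}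
    (hu : Measurable u) (hi : Integrable (fun θ => pr θ * L g d δ θ * u θ ^ 2) ν) :
    Integrable (fun θ => pr θ * L g d δ θ * Pdotop ν g pr q d δ u θ ^ 2) ν := by
  have hmove : Integrable (fun θ => pr θ * L g d δ θ
      * (∫ ϑ, moveDensity g pr q d δ θ ϑ * u ϑ ∂ν) ^ 2) ν := by
    rw [integrable_weight_sq_iff hd hpr hpr0 δ
      (measurable_integral_moveDensity_mul hd hpr hq δ hu)]
    rw [integrable_weight_sq_iff hd hpr hpr0 δ hu] at hi
    exact (lintegral_sq_move_le hd hpr hpr0 hq hq0 hq_prob δ hu).trans_lt hi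
  refine ((hmove.const_mul 2).add (hi.const_mul 2)).mono'
    ((hpr.mul (measurable_L g hd δ)).mul
      ((measurable_Pdotop hd hpr hq δ hu).pow_const 2)).aestronglyMeasurable
    (ae_of_all _ fun θ => ?_)
  have hw := mul_nonneg (hpr0 θ) (L_nonneg g d δ θ)
  have hr0 := rej_nonneg (ν := ν) (g := g) hd hpr0 hq0 hq_prob δ θ
  have hr1 := rej_le_one (ν := ν) (g := g) (d := d) hpr0 hq0 δ θ
  rw [Real.norm_of_nonneg (mul_nonneg hw (sq_nonneg _))]
  have key : Pdotop ν g pr q d δ u θ ^ 2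
      ≤ 2 * (∫ ϑ, moveDensity g pr q d δ θ ϑ * u ϑ ∂ν) ^ 2 + 2 * u θ ^ 2 := by
    change ((∫ ϑ, moveDensity g pr q d δ θ ϑ * u ϑ ∂ν) + rej ν g pr q d δ θ * u θ) ^ 2 ≤ _
    have h : rej ν g pr q d δ θ ^ 2 * u θ ^ 2 ≤ u θ ^ 2 :=
      mul_le_of_le_one_left (sq_nonneg _) (pow_le_one₀ hr0 hr1)
    nlinarith [sq_nonneg ((∫ ϑ, moveDensity g pr q d δ θ ϑ * u ϑ ∂ν)
      - rej ν g pr q d δ θ * u θ)]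
  calc pr θ * L g d δ θ * Pdotop ν g pr q d δ u θ ^ 2
      ≤ pr θ * L g d δ θ
        * (2 * (∫ ϑ, moveDensity g pr q d δ θ ϑ * u ϑ ∂ν) ^ 2 + 2 * u θ ^ 2) := by gcongr
    _ = _ := by simp only [Pi.add_apply]; ring

lemma MHop_eq {δ : ℝ} {p : T × Y} (hp : K d δ p.2 = 1) {u : T × Y → ℝ} {v : T → ℝ}
    (huv : ∀ ϑ, ∫ y', K d δ y' * u (ϑ, y') ∂(g ϑ) = L g d δ ϑ * v ϑ) :
    MHop ν g pr q d δ u p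
      = (∫ ϑ, q p.1 ϑ * alphadot pr q p.1 ϑ * L g d δ ϑ * v ϑ ∂ν)
        + rej ν g pr q d δ p.1 * u p := by
  unfold MHop rej
  simp only [accept_eq hp, mul_assoc, integral_const_mul, huv]
  rfl

/-- Iterates of the ABC-MCMC operator in terms of those of the marginal operator. -/
lemma MHop_iterate_eq [IsMarkovKernel g] (hd : Measurable d) {ε δ : ℝ} (hεδ : ε ≤ δ) (f : T → ℝ)
    (k : ℕ)
    {p : T × Y} (hp : K d δ p.2 = 1) :
    (MHop ν g pr q d δ)^[k] (fun p' => K d ε p'.2 * f p'.1) p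
      = (Pdotop ν g pr q d δ)^[k] (fun ϑ => f ϑ * wbar g d δ ε ϑ) p.1
        + rej ν g pr q d δ p.1 ^ k
          * (K d ε p.2 * f p.1 - f p.1 * wbar g d δ ε p.1) := by
  induction k generalizing p with
  | zero => simp
  | succ k ih =>
    rw [Function.iterate_succ_apply', Function.iterate_succ_apply']
    set V := (Pdotop ν g pr q d δ)^[k] (fun ϑ => f ϑ * wbar g d δ ε ϑ) with hV
    set r := rej ν g pr q d δ with hr
    rw [MHop_eq hp (v := V), ih hp]
    · unfold Pdotop
      ring
    · intro ϑ
      have hpt : ∀ y, K d δ y * (MHop ν g pr q d δ)^[k] (fun p' => K d ε p'.2 * f p'.1) (ϑ, y)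
          = K d δ y * (V ϑ - r ϑ ^ k * (f ϑ * wbar g d δ ε ϑ))
            + K d ε y * (r ϑ ^ k * f ϑ) := by
        intro y
        have hKK := K_mul_K hεδ d y
        by_cases hy : K d δ y = 1
        · rw [ih (p := (ϑ, y)) hy]
          linear_combination (r ϑ ^ k * f ϑ) * hKK
        · have hy0 : K d δ y = 0 := by
            unfold K at hy ⊢
            split_ifs at hy ⊢ <;> simp_all
          rw [hy0, zero_mul] at hKK
          rw [hy0, ← hKK]
          ring
      simp only [hpt]
      rw [integral_add ((integrable_K hd δ _).mul_const _) ((integrable_K hd ε _).mul_const _),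
        integral_mul_const, integral_mul_const]
      change L g d δ ϑ * _ + L g d ε ϑ * _ = _
      rw [← L_mul_wbar g hd hεδ ϑ]
      ring

end Chain

section Joint

variable {T Y : Type*} [MeasurableSpace T] [MeasurableSpace Y]
  {ν : Measure T} {pr : T → ℝ} {g : Kernel T Y} {d : Y → ℝ}

lemma ae_piJoint_K_eq_one (hd : Measurable d) (hpr : Measurable pr) (δ : ℝ) :
    ∀ᵐ p ∂(piJoint ν pr g d δ), K d δ p.2 = 1 := by
  refine Measure.ae_smul_measure ?_ _
  have hpK : Measurable fun p : T × Y => ENNReal.ofReal (pr p.1 * K d δ p.2) :=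
    ((hpr.comp measurable_fst).mul ((measurable_K hd δ).comp measurable_snd)).ennreal_ofReal
  rw [ae_withDensity_iff hpK]
  refine ae_of_all _ fun p hp => ?_
  unfold K at hp ⊢
  split_ifs at hp ⊢ <;> simp_all

lemma map_fst_piJoint_withDensity [SigmaFinite ν] [IsMarkovKernel g] (hd : Measurable d)
    (hpr : Measurable pr)
    (hpr0 : ∀ θ, 0 ≤ pr θ) {ε δ : ℝ} (hεδ : ε ≤ δ) :
    ((piJoint ν pr g d δ).withDensity (fun p => ENNReal.ofReal (K d ε p.2))).map Prod.fst
      = (ENNReal.ofReal (c ν pr g d δ))⁻¹ •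
        ν.withDensity (fun θ => ENNReal.ofReal (pr θ * L g d ε θ)) := by
  have hKε : Measurable fun p : T × Y => ENNReal.ofReal (K d ε p.2) :=
    ((measurable_K hd ε).comp measurable_snd).ennreal_ofReal
  have hpK : Measurable fun p : T × Y => ENNReal.ofReal (pr p.1 * K d δ p.2) :=
    ((hpr.comp measurable_fst).mul ((measurable_K hd δ).comp measurable_snd)).ennreal_ofReal
  ext s hs
  have hs' : MeasurableSet (Prod.fst ⁻¹' s : Set (T × Y)) := measurable_fst hs
  rw [Measure.map_apply measurable_fst hs, piJoint, withDensity_smul_measure,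
    Measure.smul_apply, Measure.smul_apply, ← withDensity_mul _ hpK hKε,
    withDensity_apply _ hs', withDensity_apply _ hs]
  congr 1
  rw [← Set.prod_univ, Measure.setLIntegral_compProd (hpK.mul hKε) hs MeasurableSet.univ]
  refine lintegral_congr fun θ => ?_
  rw [setLIntegral_univ, ENNReal.ofReal_mul (hpr0 θ), ← lintegral_ofReal_K g hd,
    ← lintegral_const_mul _ (measurable_K hd ε).ennreal_ofReal]
  refine lintegral_congr fun y => ?_
  simp only [Pi.mul_apply]
  rw [← ENNReal.ofReal_mul (mul_nonneg (hpr0 θ) (K_nonneg d δ y)),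
    ← ENNReal.ofReal_mul (hpr0 θ), mul_assoc, K_mul_K hεδ]

lemma integral_piJoint [SigmaFinite ν] [IsMarkovKernel g] (hd : Measurable d)
    (hpr : Measurable pr) (hpr0 : ∀ θ, 0 ≤ pr θ)
    {ε δ : ℝ} (hεδ : ε ≤ δ) {φ : T → ℝ} (hφ : Measurable φ) :
    ∫ p, K d ε p.2 * φ p.1 ∂(piJoint ν pr g d δ)
      = (ENNReal.ofReal (c ν pr g d δ))⁻¹.toReal * ∫ θ, pr θ * L g d ε θ * φ θ ∂ν := by
  have hKε : Measurable fun p : T × Y => ENNReal.ofReal (K d ε p.2) :=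
    ((measurable_K hd ε).comp measurable_snd).ennreal_ofReal
  have hw : Measurable fun θ => ENNReal.ofReal (pr θ * L g d ε θ) :=
    (hpr.mul (measurable_L g hd ε)).ennreal_ofReal
  have h := integral_map (μ := (piJoint ν pr g d δ).withDensity
    (fun p => ENNReal.ofReal (K d ε p.2))) measurable_fst.aemeasurable hφ.aestronglyMeasurable
  rw [map_fst_piJoint_withDensity hd hpr hpr0 hεδ, integral_smul_measure,
    integral_withDensity_eq_integral_toReal_smul hw (by simp),
    integral_withDensity_eq_integral_toReal_smul hKε (by simp)] at h
  simp only [smul_eq_mul, ENNReal.toReal_ofReal (K_nonneg d ε _),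
    ENNReal.toReal_ofReal (mul_nonneg (hpr0 _) (L_nonneg g d ε _))] at h
  exact h.symm

lemma integrable_piJoint [SigmaFinite ν] [IsMarkovKernel g] (hd : Measurable d)
    (hpr : Measurable pr) (hpr0 : ∀ θ, 0 ≤ pr θ)
    {ε δ : ℝ} (hεδ : ε ≤ δ) (hc : 0 < c ν pr g d δ) {φ : T → ℝ}
    (hi : Integrable (fun θ => pr θ * L g d ε θ * φ θ) ν) :
    Integrable (fun p => K d ε p.2 * φ p.1) (piJoint ν pr g d δ) := by
  have hKε : Measurable fun p : T × Y => ENNReal.ofReal (K d ε p.2) :=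
    ((measurable_K hd ε).comp measurable_snd).ennreal_ofReal
  have hw : Measurable fun θ => ENNReal.ofReal (pr θ * L g d ε θ) :=
    (hpr.mul (measurable_L g hd ε)).ennreal_ofReal
  have h : Integrable φ ((ENNReal.ofReal (c ν pr g d δ))⁻¹ •
      ν.withDensity (fun θ => ENNReal.ofReal (pr θ * L g d ε θ))) := by
    refine Integrable.smul_measure ?_ (by simpa using hc)
    rw [integrable_withDensity_iff_integrable_smul' hw (by simp)]
    simpa only [smul_eq_mul, ENNReal.toReal_ofReal (mul_nonneg (hpr0 _) (L_nonneg g d ε _))]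
      using hi
  rw [← map_fst_piJoint_withDensity hd hpr hpr0 hεδ] at h
  have h' := h.comp_measurable measurable_fst
  rw [integrable_withDensity_iff_integrable_smul' hKε (by simp)] at h'
  simpa only [smul_eq_mul, ENNReal.toReal_ofReal (K_nonneg d ε _), Function.comp_apply] using h'

lemma integral_piPost [IsMarkovKernel g] (hd : Measurable d) (hpr : Measurable pr)
    (hpr0 : ∀ θ, 0 ≤ pr θ)
    (δ : ℝ) (φ : T → ℝ) :
    ∫ θ, φ θ ∂(piPost ν pr g d δ)
      = (ENNReal.ofReal (c ν pr g d δ))⁻¹.toReal * ∫ θ, pr θ * L g d δ θ * φ θ ∂ν := by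
  have hw : Measurable fun θ => ENNReal.ofReal (pr θ * L g d δ θ) :=
    (hpr.mul (measurable_L g hd δ)).ennreal_ofReal
  rw [piPost, integral_smul_measure, integral_withDensity_eq_integral_toReal_smul hw (by simp)]
  simp only [smul_eq_mul, ENNReal.toReal_ofReal (mul_nonneg (hpr0 _) (L_nonneg g d δ _))]

lemma integrable_weight_sq_of_piPost [IsMarkovKernel g] (hd : Measurable d) (hpr : Measurable pr)
    (hpr0 : ∀ θ, 0 ≤ pr θ) {ε : ℝ} {f : T → ℝ} (hf : Measurable f)
    (hf2 : ∫⁻ θ, ENNReal.ofReal (f θ ^ 2) ∂(piPost ν pr g d ε) < ⊤) :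
    Integrable (fun θ => pr θ * L g d ε θ * f θ ^ 2) ν := by
  rw [integrable_weight_sq_iff hd hpr hpr0 ε hf]
  have hw : Measurable fun θ => ENNReal.ofReal (pr θ * L g d ε θ) :=
    (hpr.mul (measurable_L g hd ε)).ennreal_ofReal
  rw [piPost, lintegral_smul_measure, lintegral_withDensity_eq_lintegral_mul _
    hw (hf.pow_const 2).ennreal_ofReal,
    smul_eq_mul] at hf2
  have h := ENNReal.lt_top_of_mul_ne_top_right hf2.ne (by simp)
  refine lt_of_eq_of_lt (lintegral_congr fun θ => ?_) h
  rw [Pi.mul_apply, ← Real.enorm_of_nonneg (sq_nonneg (f θ)), enorm_pow]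

end Joint

end ABCsimple

theorem stmt4 {T Y : Type*} [MeasurableSpace T] [MeasurableSpace Y]
    (ν : Measure T) [SigmaFinite ν]
    (pr : T → ℝ) (hpr_meas : Measurable pr) (hpr_nonneg : ∀ θ, 0 ≤ pr θ)
    (hpr_prob : ∫ θ, pr θ ∂ν = 1)
    (g : Kernel T Y) [IsMarkovKernel g]
    (d : Y → ℝ) (hd_meas : Measurable d) (hd_nonneg : ∀ y, 0 ≤ d y)
    (q : T → T → ℝ) (hq_meas : Measurable (fun p : T × T => q p.1 p.2))
    (hq_nonneg : ∀ θ ϑ, 0 ≤ q θ ϑ) (hq_prob : ∀ θ, ∫ ϑ, q θ ϑ ∂ν = 1)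
    (ε δ : ℝ) (hε : 0 < ε) (hεδ : ε ≤ δ)
    (hcδ : 0 < c ν pr g d δ) (hcε : 0 < c ν pr g d ε)
    (f : T → ℝ) (hf_meas : Measurable f)
    (hf2 : ∫⁻ θ, ENNReal.ofReal ((f θ) ^ 2) ∂(piPost ν pr g d ε) < ⊤) :
    ∀ k : ℕ, 1 ≤ k →
      ∫ p, (K d ε p.2 * f p.1) *
          ((MHop ν g pr q d δ)^[k] (fun p' => K d ε p'.2 * f p'.1)) p
          ∂(piJoint ν pr g d δ)
        = (∫ θ, (f θ * wbar g d δ ε θ) *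
              ((Pdotop ν g pr q d δ)^[k] (fun ϑ => f ϑ * wbar g d δ ε ϑ)) θ
              ∂(piPost ν pr g d δ))
          + ∫ p, ((K d ε p.2 * f p.1) ^ 2 - (f p.1 * wbar g d δ ε p.1) ^ 2) *
              (rej ν g pr q d δ p.1) ^ k ∂(piJoint ν pr g d δ) := by
  intro k _
  set fw : T → ℝ := fun ϑ => f ϑ * wbar g d δ ε ϑ with hfw
  set r := rej ν g pr q d δ with hr
  have hLε := L_nonneg g d ε
  have hr_meas : Measurable r := measurable_rej hd_meas hpr_meas hq_meas δ
  have hr0 : ∀ θ, 0 ≤ r θ := rej_nonneg hd_meas hpr_nonneg hq_nonneg hq_prob δ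
  have hr1 : ∀ θ, r θ ≤ 1 := rej_le_one hpr_nonneg hq_nonneg δ
  have hfw_meas : Measurable fw := hf_meas.mul (measurable_wbar g hd_meas δ ε)
  have hLw : ∀ θ, L g d δ θ * fw θ = L g d ε θ * f θ := fun θ => by
    rw [← L_mul_wbar g hd_meas hεδ θ, hfw]; ring
  have hLε_meas := measurable_L g hd_meas ε
  have hLδ_meas := measurable_L g hd_meas δ
  have hf_int : Integrable (fun θ => pr θ * L g d ε θ * f θ ^ 2) ν :=
    integrable_weight_sq_of_piPost hd_meas hpr_meas hpr_nonneg hf_meas hf2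
  have hfw_int : Integrable (fun θ => pr θ * L g d δ θ * fw θ ^ 2) ν := by
    refine hf_int.mono'
      ((hpr_meas.mul hLδ_meas).mul (hfw_meas.pow_const 2)).aestronglyMeasurable
      (ae_of_all _ fun θ => ?_)
    rw [Real.norm_of_nonneg
      (mul_nonneg (mul_nonneg (hpr_nonneg θ) (L_nonneg g d δ θ)) (sq_nonneg _))]
    have h : pr θ * L g d δ θ * fw θ ^ 2 = pr θ * L g d ε θ * f θ ^ 2 * wbar g d δ ε θ := by
      rw [← L_mul_wbar g hd_meas hεδ θ, hfw]; ring
    rw [h]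
    exact mul_le_of_le_one_right
      (mul_nonneg (mul_nonneg (hpr_nonneg θ) (hLε θ)) (sq_nonneg _))
      (wbar_le_one g hd_meas hεδ θ)
  have hiter : ∀ n : ℕ, Measurable ((Pdotop ν g pr q d δ)^[n] fw) ∧
      Integrable (fun θ => pr θ * L g d δ θ * ((Pdotop ν g pr q d δ)^[n] fw) θ ^ 2) ν := by
    intro n
    induction n with
    | zero => exact ⟨hfw_meas, hfw_int⟩
    | succ n ih =>
      rw [Function.iterate_succ_apply']
      exact ⟨measurable_Pdotop hd_meas hpr_meas hq_meas δ ih.1,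
        integrable_weight_sq_Pdotop hd_meas hpr_meas hpr_nonneg hq_meas hq_nonneg hq_prob δ
          ih.1 ih.2⟩
  obtain ⟨hV_meas, hV_int⟩ := hiter k
  set V := (Pdotop ν g pr q d δ)^[k] fw with hV
  have hcross : ∀ {u : T → ℝ}, Measurable u →
      Integrable (fun θ => pr θ * L g d δ θ * u θ ^ 2) ν →
      Integrable (fun θ => pr θ * L g d ε θ * (f θ * u θ)) ν := by
    intro u hu hui
    refine (hf_int.add hui).mono'
      ((hpr_meas.mul hLε_meas).mul (hf_meas.mul hu)).aestronglyMeasurable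
      (ae_of_all _ fun θ => ?_)
    have hw := mul_nonneg (hpr_nonneg θ) (hLε θ)
    rw [norm_mul, Real.norm_of_nonneg hw, Real.norm_eq_abs]
    have h₁ : |f θ * u θ| ≤ f θ ^ 2 + u θ ^ 2 := by
      rw [abs_le]
      constructor <;> nlinarith [sq_nonneg (f θ + u θ), sq_nonneg (f θ - u θ)]
    have h₂ : pr θ * L g d ε θ ≤ pr θ * L g d δ θ :=
      mul_le_mul_of_nonneg_left (L_mono g hd_meas hεδ θ) (hpr_nonneg θ)
    have h₃ := mul_le_mul_of_nonneg_left h₁ hw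
    have h₄ := mul_le_mul_of_nonneg_right h₂ (sq_nonneg (u θ))
    simp only [Pi.add_apply]
    linarith
  have hrk : ∀ {ψ : T → ℝ}, Integrable ψ ν → Integrable (fun θ => ψ θ * r θ ^ k) ν := by
    intro ψ hψ
    refine hψ.mul_bdd (c := 1) (hr_meas.pow_const k).aestronglyMeasurable
      (ae_of_all _ fun θ => ?_)
    rw [Real.norm_of_nonneg (pow_nonneg (hr0 θ) k)]
    exact pow_le_one₀ (hr0 θ) (hr1 θ)
  have hi₁ : Integrable (fun p => K d ε p.2 * (f p.1 * V p.1)) (piJoint ν pr g d δ) :=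
    integrable_piJoint hd_meas hpr_meas hpr_nonneg hεδ hcδ (φ := fun θ => f θ * V θ)
      (hcross hV_meas hV_int)
  have hi₂ : Integrable (fun p => K d ε p.2 * (f p.1 ^ 2 * r p.1 ^ k)) (piJoint ν pr g d δ) :=
    integrable_piJoint hd_meas hpr_meas hpr_nonneg hεδ hcδ (φ := fun θ => f θ ^ 2 * r θ ^ k)
      ((hrk hf_int).congr (ae_of_all _ fun θ => mul_assoc _ _ _))
  have hi₃ : Integrable (fun p => K d ε p.2 * (f p.1 * fw p.1 * r p.1 ^ k))
      (piJoint ν pr g d δ) :=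
    integrable_piJoint hd_meas hpr_meas hpr_nonneg hεδ hcδ
      (φ := fun θ => f θ * fw θ * r θ ^ k)
      ((hrk (hcross hfw_meas hfw_int)).congr (ae_of_all _ fun θ => mul_assoc _ _ _))
  have hi₄ : Integrable (fun p => K d δ p.2 * (fw p.1 ^ 2 * r p.1 ^ k)) (piJoint ν pr g d δ) :=
    integrable_piJoint hd_meas hpr_meas hpr_nonneg le_rfl hcδ (φ := fun θ => fw θ ^ 2 * r θ ^ k)
      ((hrk hfw_int).congr (ae_of_all _ fun θ => mul_assoc _ _ _))
  have hK := ae_piJoint_K_eq_one (ν := ν) (g := g) hd_meas hpr_meas δ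
  have hlhs : ∫ p, (K d ε p.2 * f p.1) *
        ((MHop ν g pr q d δ)^[k] (fun p' => K d ε p'.2 * f p'.1)) p ∂(piJoint ν pr g d δ)
      = ∫ p, (K d ε p.2 * (f p.1 * V p.1) + K d ε p.2 * (f p.1 ^ 2 * r p.1 ^ k)
          - K d ε p.2 * (f p.1 * fw p.1 * r p.1 ^ k)) ∂(piJoint ν pr g d δ) := by
    refine integral_congr_ae (hK.mono fun p hp => ?_)
    simp only
    rw [MHop_iterate_eq hd_meas hεδ f k hp]
    linear_combination (f p.1 ^ 2 * r p.1 ^ k) * K_mul_self d ε p.2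
  have hrhs : ∫ p, ((K d ε p.2 * f p.1) ^ 2 - (f p.1 * wbar g d δ ε p.1) ^ 2) * r p.1 ^ k
        ∂(piJoint ν pr g d δ)
      = ∫ p, (K d ε p.2 * (f p.1 ^ 2 * r p.1 ^ k)
          - K d δ p.2 * (fw p.1 ^ 2 * r p.1 ^ k)) ∂(piJoint ν pr g d δ) := by
    refine integral_congr_ae (hK.mono fun p hp => ?_)
    simp only [hp]
    linear_combination (f p.1 ^ 2 * r p.1 ^ k) * K_mul_self d ε p.2
  have e₁ : ∫ p, K d ε p.2 * (f p.1 * V p.1) ∂(piJoint ν pr g d δ)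
      = ∫ θ, fw θ * V θ ∂(piPost ν pr g d δ) := by
    rw [integral_piPost hd_meas hpr_meas hpr_nonneg]
    refine (integral_piJoint hd_meas hpr_meas hpr_nonneg hεδ (hf_meas.mul hV_meas)).trans ?_
    congr 2 with θ
    simp only [Pi.mul_apply]
    linear_combination -(pr θ * V θ) * hLw θ
  have e₂ : ∫ p, K d ε p.2 * (f p.1 * fw p.1 * r p.1 ^ k) ∂(piJoint ν pr g d δ)
      = ∫ p, K d δ p.2 * (fw p.1 ^ 2 * r p.1 ^ k) ∂(piJoint ν pr g d δ) := by
    refine (integral_piJoint hd_meas hpr_meas hpr_nonneg hεδ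
      ((hf_meas.mul hfw_meas).mul (hr_meas.pow_const k))).trans ?_
    refine Eq.trans ?_ (integral_piJoint hd_meas hpr_meas hpr_nonneg le_rfl
      ((hfw_meas.pow_const 2).mul (hr_meas.pow_const k))).symm
    congr 2 with θ
    simp only [Pi.mul_apply]
    linear_combination -(pr θ * fw θ * r θ ^ k) * hLw θ
  rw [hlhs, hrhs, integral_sub (hi₁.fun_add hi₂) hi₃, integral_add hi₁ hi₂,
    integral_sub hi₂ hi₄, e₁, e₂]
  ring
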